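/- arXiv:2107.12998 — 4 statements merged into one kernel-verified Lean document; each statement's English description precedes it below -/
import Mathlib

section
/- Heine formula. Let (X, μ) be a measure space, Y : X → ℂ and φ_a, φ∨_a : X → ℂ (0 ≤ a ≤ n) measurable functions such that Y·φ_a·φ∨_b is μ-integrable for all 0 ≤ a, b ≤ n. Set m_{a,b} := ∫_X Y φ_a φ∨_b dμ and define the function ψ_n(p) := ∑_{i=0}^n (−1)^{n+i} det(M_i) · φ_i(p), where M_i is the n×n matrix obtained from [m_{a,b}]_{0≤a≤n, 0≤b≤n−1} by deleting row i. Then for every p ∈ X: ψ_n(p) = (1/n!) ∫_{X^n} det(A(p; p_1,…,p_n)) · det(B(p_1,…,p_n)) · ∏_{j=1}^n Y(p_j) dμ^{⊗n}(p_1,…,p_n), where A is the (n+1)×(n+1) matrix with A_{a,b} = φ_a(p_{b+1}) for 0 ≤ b ≤ n−1 and A_{a,n} = φ_a(p), and B is the n×n matrix with B_{a,b} = φ∨_a(p_{b+1}) for 0 ≤ a, b ≤ n−1. -/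
open scoped BigOperators
open MeasureTheory

lemma andreief_aux {X : Type*} [MeasurableSpace X] (μ : Measure X) [SigmaFinite μ]
    (n : ℕ) (Y : X → ℂ) (f g : Fin n → X → ℂ)
    (hint : ∀ a b, Integrable (fun x => Y x * f a x * g b x) μ) :
    Integrable (fun x : Fin n → X => Matrix.det (Matrix.of fun a b : Fin n => f a (x b)) *
        Matrix.det (Matrix.of fun a b : Fin n => g a (x b)) * ∏ j : Fin n, Y (x j))
        (Measure.pi fun _ : Fin n => μ) ∧
    ∫ x : Fin n → X, Matrix.det (Matrix.of fun a b : Fin n => f a (x b)) *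
        Matrix.det (Matrix.of fun a b : Fin n => g a (x b)) * ∏ j : Fin n, Y (x j)
        ∂(Measure.pi fun _ : Fin n => μ)
      = (n.factorial : ℂ) *
        Matrix.det (Matrix.of fun a b : Fin n => ∫ x, Y x * f a x * g b x ∂μ) := by
  have key : (fun x : Fin n → X => Matrix.det (Matrix.of fun a b : Fin n => f a (x b)) *
        Matrix.det (Matrix.of fun a b : Fin n => g a (x b)) * ∏ j : Fin n, Y (x j))
      = fun x => ∑ τ : Equiv.Perm (Fin n), ∑ σ : Equiv.Perm (Fin n),
          (((Equiv.Perm.sign τ : ℤ) : ℂ) * ((Equiv.Perm.sign σ : ℤ) : ℂ)) *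
            ∏ j, (Y (x j) * f (σ j) (x j) * g (τ j) (x j)) := by
    funext x
    rw [Matrix.det_apply', Matrix.det_apply', Finset.sum_mul_sum, Finset.sum_mul, Finset.sum_comm]
    simp only [Finset.sum_mul]
    rw [Finset.sum_comm]
    simp only [Matrix.of_apply, Finset.prod_mul_distrib]
    rw [Finset.sum_comm]
    refine Finset.sum_congr rfl fun τ _ => Finset.sum_congr rfl fun σ _ => ?_
    ring
  have hI : ∀ τ σ : Equiv.Perm (Fin n), Integrable (fun x : Fin n → X =>
      (((Equiv.Perm.sign τ : ℤ) : ℂ) * ((Equiv.Perm.sign σ : ℤ) : ℂ)) *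
            ∏ j, (Y (x j) * f (σ j) (x j) * g (τ j) (x j))) (Measure.pi fun _ : Fin n => μ) := by
    intro τ σ
    refine Integrable.const_mul ?_ _
    exact Integrable.fintype_prod (f := fun j y => Y y * f (σ j) y * g (τ j) y)
      (fun j => hint _ _)
  rw [key]
  refine ⟨integrable_finsetSum _ fun τ _ => integrable_finsetSum _ fun σ _ => hI τ σ, ?_⟩
  rw [integral_finsetSum _ fun τ _ => integrable_finsetSum _ fun σ _ => hI τ σ]
  have h2 : ∀ τ : Equiv.Perm (Fin n), (∫ x : Fin n → X, ∑ σ : Equiv.Perm (Fin n),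
          (((Equiv.Perm.sign τ : ℤ) : ℂ) * ((Equiv.Perm.sign σ : ℤ) : ℂ)) *
            ∏ j, (Y (x j) * f (σ j) (x j) * g (τ j) (x j)) ∂(Measure.pi fun _ : Fin n => μ))
      = Matrix.det (Matrix.of fun a b : Fin n => ∫ x, Y x * f a x * g b x ∂μ) := by
    intro τ
    rw [integral_finsetSum _ fun σ _ => hI τ σ]
    have h3 := Matrix.det_permute' τ (Matrix.of fun a b : Fin n => ∫ x, Y x * f a x * g b x ∂μ)
    have h4 : ((Equiv.Perm.sign τ : ℤ) : ℂ) * ((Equiv.Perm.sign τ : ℤ) : ℂ) = 1 := by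
      rw [← Int.cast_mul, ← Units.val_mul, Int.units_mul_self]; simp
    rw [← one_mul (Matrix.det _), ← h4, mul_assoc, ← h3, Matrix.det_apply', Finset.mul_sum]
    refine Finset.sum_congr rfl fun σ _ => ?_
    rw [integral_const_mul,
      integral_fintype_prod_eq_prod (f := fun j y => Y y * f (σ j) y * g (τ j) y), mul_assoc]
    rfl
  rw [Finset.sum_congr rfl fun τ _ => h2 τ]
  simp [Fintype.card_perm]

/-- Heine formula for the bordered-determinant biorthogonal section. -/
theorem stmt_2 {X : Type*} [MeasurableSpace X] (μ : Measure X) [SigmaFinite μ]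
    (n : ℕ) (Y : X → ℂ) (φ φv : ℕ → X → ℂ)
    (hY : Measurable Y)
    (hφ : ∀ a ≤ n, Measurable (φ a)) (hφv : ∀ a ≤ n, Measurable (φv a))
    (hint : ∀ a ≤ n, ∀ b ≤ n, Integrable (fun x => Y x * φ a x * φv b x) μ)
    (m : ℕ → ℕ → ℂ) (hm : ∀ a b, m a b = ∫ x, Y x * φ a x * φv b x ∂μ)
    (p : X) :
    ∑ i : Fin (n + 1),
        ((-1 : ℂ) ^ (n + (i : ℕ)) *
          Matrix.det (Matrix.of fun a b : Fin n =>
            m ((i.succAbove a : Fin (n + 1)) : ℕ) (b : ℕ))) * φ (i : ℕ) p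
      = (1 / (n.factorial : ℂ)) *
        ∫ x : Fin n → X,
          Matrix.det (Matrix.of fun a b : Fin (n + 1) =>
            if hb : (b : ℕ) < n then φ (a : ℕ) (x ⟨b, hb⟩) else φ (a : ℕ) p) *
          Matrix.det (Matrix.of fun a b : Fin n => φv (a : ℕ) (x b)) *
          ∏ j : Fin n, Y (x j)
          ∂(Measure.pi fun _ : Fin n => μ) := by
  have hA : ∀ i : Fin (n + 1), _ := fun i => andreief_aux μ n Y
    (fun a => φ ((i.succAbove a : Fin (n + 1)) : ℕ)) (fun b => φv (b : ℕ))
    (fun a b => hint _ (by omega) _ (by omega))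
  have key : (fun x : Fin n → X => Matrix.det (Matrix.of fun a b : Fin (n + 1) =>
            if hb : (b : ℕ) < n then φ (a : ℕ) (x ⟨b, hb⟩) else φ (a : ℕ) p) *
          Matrix.det (Matrix.of fun a b : Fin n => φv (a : ℕ) (x b)) *
          ∏ j : Fin n, Y (x j)) = fun x => ∑ i : Fin (n + 1),
          ((-1 : ℂ) ^ (n + (i : ℕ)) * φ (i : ℕ) p) *
          (Matrix.det (Matrix.of fun a b : Fin n => φ ((i.succAbove a : Fin (n + 1)) : ℕ) (x b)) *
          Matrix.det (Matrix.of fun a b : Fin n => φv (a : ℕ) (x b)) *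
          ∏ j : Fin n, Y (x j)) := by
    funext x
    rw [Matrix.det_succ_column _ (Fin.last n), Finset.sum_mul, Finset.sum_mul]
    refine Finset.sum_congr rfl fun i _ => ?_
    have : (Matrix.of fun a b : Fin (n + 1) =>
            if hb : (b : ℕ) < n then φ (a : ℕ) (x ⟨b, hb⟩) else φ (a : ℕ) p).submatrix
              i.succAbove (Fin.last n).succAbove =
        Matrix.of fun a b : Fin n => φ ((i.succAbove a : Fin (n + 1)) : ℕ) (x b) := by
      ext a b
      simp
    rw [this]
    simp only [Matrix.of_apply, Fin.val_last, lt_irrefl, dite_false]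
    rw [add_comm (i : ℕ) n]
    ring
  rw [key, integral_finsetSum _ fun i _ => (hA i).1.const_mul _, Finset.mul_sum]
  refine Finset.sum_congr rfl fun i _ => ?_
  rw [integral_const_mul, (hA i).2]
  have hn : (n.factorial : ℂ) ≠ 0 := by exact_mod_cast n.factorial_ne_zero
  simp only [hm]
  field_simp
end

section
/- Let r ≥ 1, let Z ∈ ℂ[t] be a monic polynomial of degree r, and let ψ : ℕ → ℂ[t] be a sequence of polynomials with deg ψ_ℓ = ℓ for every ℓ. Then for each k ∈ ℕ there exists an r×r matrix F^{(k)} with entries in ℂ[z] such that ψ_{kr+a}(t) = ∑_{ℓ=0}^{r−1} F^{(k)}_{a,ℓ}(Z(t)) · ψ_ℓ(t) for all a ∈ {0,…,r−1}, every entry F^{(k)}_{a,ℓ} has degree ≤ k, and the r×r complex matrix whose (a,ℓ) entry is the coefficient of z^k in F^{(k)}_{a,ℓ} is invertible. -/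
open scoped BigOperators
open Polynomial

lemma aux_basis (r : ℕ) (Z : Polynomial ℂ)
    (hZm : Z.Monic) (hZdeg : Z.natDegree = r)
    (ψ : ℕ → Polynomial ℂ) (hψ : ∀ ℓ : ℕ, (ψ ℓ).degree = (ℓ : WithBot ℕ)) (k a : ℕ) :
    (Z ^ k * ψ a).degree = ((k * r + a : ℕ) : WithBot ℕ) := by
  have hZ : Z.degree = (r : WithBot ℕ) := by
    rw [Polynomial.degree_eq_natDegree hZm.ne_zero, hZdeg]
  rw [Polynomial.degree_mul, Polynomial.degree_pow, hψ, hZ]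
  simp

lemma aux_step (p q : Polynomial ℂ) (n : ℕ) (hq : q.degree = (n : WithBot ℕ))
    (hp : p.degree < ((n + 1 : ℕ) : WithBot ℕ)) :
    ∃ c : ℂ, (p - C c * q).degree < (n : WithBot ℕ) ∧ (p.degree = (n : WithBot ℕ) → c ≠ 0) := by
  have hqn : q.coeff n ≠ 0 := Polynomial.coeff_ne_zero_of_eq_degree hq
  refine ⟨p.coeff n / q.coeff n, ?_, ?_⟩
  · rw [Polynomial.degree_lt_iff_coeff_zero] at hp ⊢
    intro m hm
    rw [Polynomial.coeff_sub, Polynomial.coeff_C_mul]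
    rcases hm.eq_or_lt with h | h
    · subst h
      field_simp
      simp
    · rw [hp m h, Polynomial.coeff_eq_zero_of_degree_lt (p := q) (n := m) (by rw [hq]; exact_mod_cast h)]
      simp
  · intro h
    exact div_ne_zero (Polynomial.coeff_ne_zero_of_eq_degree h) hqn

lemma aux_add (r : ℕ) (Z : Polynomial ℂ) (ψ : ℕ → Polynomial ℂ) (p : Polynomial ℂ) (c : ℂ)
    (k : ℕ) (a : Fin r) (F : Fin r → Polynomial ℂ)
    (hF : p - C c * (Z ^ k * ψ a) = ∑ ℓ : Fin r, (F ℓ).comp Z * ψ (ℓ : ℕ)) :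
    p = ∑ ℓ : Fin r, (F ℓ + if ℓ = a then C c * X ^ k else 0).comp Z * ψ (ℓ : ℕ) := by
  have h : ∀ ℓ : Fin r, (F ℓ + if ℓ = a then C c * X ^ k else 0).comp Z * ψ (ℓ : ℕ)
      = (F ℓ).comp Z * ψ (ℓ : ℕ) + if ℓ = a then C c * (Z ^ k * ψ a) else 0 := by
    intro ℓ
    split_ifs with h
    · subst h
      simp
      ring
    · simp
  simp_rw [h]
  rw [Finset.sum_add_distrib, ← hF]
  simp

lemma aux_expand (r : ℕ) (hr : 1 ≤ r) (Z : Polynomial ℂ)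
    (hZm : Z.Monic) (hZdeg : Z.natDegree = r)
    (ψ : ℕ → Polynomial ℂ) (hψ : ∀ ℓ : ℕ, (ψ ℓ).degree = (ℓ : WithBot ℕ)) (n : ℕ) :
    ∀ p : Polynomial ℂ, p.degree < (n : WithBot ℕ) → ∃ F : Fin r → Polynomial ℂ,
      p = ∑ ℓ : Fin r, (F ℓ).comp Z * ψ (ℓ : ℕ) ∧
      ∀ (ℓ : Fin r) (j : ℕ), n ≤ j * r + ℓ → (F ℓ).coeff j = 0 := by
  induction n with
  | zero =>
    intro p hp
    have : p = 0 := by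
      ext m
      exact (Polynomial.degree_lt_iff_coeff_zero p 0).1 hp m (Nat.zero_le _)
    exact ⟨fun _ => 0, by simp [this], by simp⟩
  | succ n ih =>
    intro p hp
    have hn : n / r * r + n % r = n := Nat.div_add_mod' n r
    have hq := aux_basis r Z hZm hZdeg ψ hψ (n / r) (n % r)
    rw [hn] at hq
    obtain ⟨c, hc, -⟩ := aux_step p _ n hq hp
    obtain ⟨F, hF, hF'⟩ := ih _ hc
    refine ⟨_, aux_add r Z ψ p c (n / r) ⟨n % r, Nat.mod_lt _ hr⟩ F hF, ?_⟩
    intro ℓ j hj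
    rw [Polynomial.coeff_add, hF' ℓ j (by omega)]
    split_ifs with h
    · subst h
      have : j ≠ n / r := by
        rintro rfl
        simp only at hj
        omega
      simp [Polynomial.coeff_X_pow, this]
    · simp

/-- The block expansion `ψ_{kr+a} = ∑_ℓ F^{(k)}_{a,ℓ}(Z) ψ_ℓ` with polynomial
entries of degree ≤ k and invertible leading coefficient matrix. -/
theorem stmt_4 (r : ℕ) (hr : 1 ≤ r) (Z : Polynomial ℂ)
    (hZm : Z.Monic) (hZdeg : Z.natDegree = r)
    (ψ : ℕ → Polynomial ℂ) (hψ : ∀ ℓ : ℕ, (ψ ℓ).degree = (ℓ : WithBot ℕ))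
    (k : ℕ) :
    ∃ F : Matrix (Fin r) (Fin r) (Polynomial ℂ),
      (∀ a : Fin r, ψ (k * r + (a : ℕ)) = ∑ ℓ : Fin r, (F a ℓ).comp Z * ψ (ℓ : ℕ)) ∧
      (∀ a ℓ : Fin r, (F a ℓ).natDegree ≤ k) ∧
      IsUnit (Matrix.of fun a ℓ : Fin r => (F a ℓ).coeff k) := by
  have key : ∀ a : Fin r, ∃ F : Fin r → Polynomial ℂ,
      ψ (k * r + (a : ℕ)) = ∑ ℓ : Fin r, (F ℓ).comp Z * ψ (ℓ : ℕ) ∧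
      (∀ ℓ, (F ℓ).natDegree ≤ k) ∧ (∀ ℓ, a < ℓ → (F ℓ).coeff k = 0) ∧ (F a).coeff k ≠ 0 := by
    intro a
    have hq := aux_basis r Z hZm hZdeg ψ hψ k a
    obtain ⟨c, hc, hc0⟩ := aux_step (ψ (k * r + a)) _ _ hq
      (by rw [hψ]; exact_mod_cast Nat.lt_succ_self _)
    have hc0 := hc0 (hψ _)
    obtain ⟨F, hF, hF'⟩ := aux_expand r hr Z hZm hZdeg ψ hψ _ _ hc
    refine ⟨_, aux_add r Z ψ _ c k a F hF, ?_, ?_, ?_⟩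
    · intro ℓ
      rw [Polynomial.natDegree_le_iff_coeff_eq_zero]
      intro j hj
      have h1 : (k + 1) * r ≤ j * r := Nat.mul_le_mul_right r hj
      have h2 := a.2
      rw [Polynomial.coeff_add, hF' ℓ j (by rw [add_mul] at h1; omega)]
      split_ifs
      · simp [Polynomial.coeff_X_pow, hj.ne']
      · simp
    · intro ℓ h
      have : (a : ℕ) < ℓ := h
      rw [Polynomial.coeff_add, hF' ℓ k (by omega), if_neg h.ne']
      simp
    · rw [Polynomial.coeff_add, hF' a k le_rfl]
      simpa using hc0
  choose F h1 h2 h3 h4 using key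
  refine ⟨Matrix.of F, h1, h2, ?_⟩
  rw [Matrix.isUnit_iff_isUnit_det, Matrix.det_of_lowerTriangular]
  · rw [isUnit_iff_ne_zero, Finset.prod_ne_zero_iff]
    intro a _
    exact h4 a
  · intro a ℓ h
    exact h3 a ℓ h
end

section
/- Matrix biorthogonality from scalar biorthogonality. Let (X, μ) be a measure space, Y : X → ℂ, Z : X → ℂ, r ≥ 1, φ, φ∨ : {0,…,r−1} → (X → ℂ), ψ, ψ∨ : ℕ → (X → ℂ), and h : ℕ → ℂ, such that: (i) for all n, m the function Y·ψ_n·ψ∨_m is μ-integrable and ∫_X ψ_n ψ∨_m Y dμ = δ_{n,m} h_n; (ii) there are sequences of r×r matrices of polynomials P_k, P∨_k (entries in ℂ[z]) such that for all k, all a, b ∈ {0,…,r−1}, and all p ∈ X: ψ_{kr+a}(p) = ∑_{ℓ=0}^{r−1} (P_k)_{a,ℓ}(Z(p)) · φ_ℓ(p) and ψ∨_{kr+b}(p) = ∑_{m=0}^{r−1} φ∨_m(p) · (P∨_k)_{m,b}(Z(p)). Then for all k, ℓ ∈ ℕ the matrix-valued integral ∫_X P_k(Z(p)) · (φ(p)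 φ∨(p)ᵀ) · P∨_ℓ(Z(p)) · Y(p) dμ(p) equals δ_{k,ℓ} · diag(h_{kr}, h_{kr+1}, …, h_{kr+r−1}), where φ(p) φ∨(p)ᵀ denotes the r×r matrix with (m,m') entry φ_m(p) φ∨_{m'}(p). -/
open scoped BigOperators
open MeasureTheory Polynomial

/-- Matrix biorthogonality from scalar biorthogonality:
`∫ P_k(Z) (φ φ∨ᵀ) P∨_ℓ(Z) Y dμ = δ_{k,ℓ} diag(h_{kr},…,h_{kr+r-1})` (entrywise). -/
theorem stmt_7 {X : Type*} [MeasurableSpace X] (μ : Measure X)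
    (Y Z : X → ℂ) (r : ℕ) (hr : 1 ≤ r)
    (φ φv : Fin r → X → ℂ) (ψ ψv : ℕ → X → ℂ) (h : ℕ → ℂ)
    (hint : ∀ n m, Integrable (fun p => Y p * ψ n p * ψv m p) μ)
    (horth : ∀ n m, ∫ p, ψ n p * ψv m p * Y p ∂μ = if n = m then h n else 0)
    (P Pv : ℕ → Matrix (Fin r) (Fin r) (Polynomial ℂ))
    (hP : ∀ (k : ℕ) (a : Fin r) (p : X),
      ψ (k * r + (a : ℕ)) p = ∑ ℓ : Fin r, ((P k) a ℓ).eval (Z p) * φ ℓ p)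
    (hPv : ∀ (k : ℕ) (b : Fin r) (p : X),
      ψv (k * r + (b : ℕ)) p = ∑ m : Fin r, φv m p * ((Pv k) m b).eval (Z p))
    (k l : ℕ) (a b : Fin r) :
    ∫ p, ((P k).map (Polynomial.eval (Z p)) *
          Matrix.of (fun m m' : Fin r => φ m p * φv m' p) *
          (Pv l).map (Polynomial.eval (Z p))) a b * Y p ∂μ
      = if k = l then (if a = b then h (k * r + (a : ℕ)) else 0) else 0 := by
  have e : ∀ p, ((P k).map (Polynomial.eval (Z p)) *
          Matrix.of (fun m m' : Fin r => φ m p * φv m' p) *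
          (Pv l).map (Polynomial.eval (Z p))) a b
      = ψ (k * r + (a : ℕ)) p * ψv (l * r + (b : ℕ)) p := by
    intro p
    rw [hP, hPv, Matrix.mul_apply, Finset.mul_sum]
    refine Finset.sum_congr rfl fun m _ => ?_
    rw [Matrix.mul_apply, ← mul_assoc]
    simp only [Matrix.map_apply, Matrix.of_apply, Finset.sum_mul, mul_assoc]
  simp_rw [e]
  rw [horth]
  have key : k * r + (a : ℕ) = l * r + (b : ℕ) ↔ k = l ∧ a = b := by
    constructor
    · intro H
      have h1 := congrArg (· / r) H
      have h2 := congrArg (· % r) H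
      have hr' : 0 < r := hr
      simp only [Nat.add_div_of_dvd_right (Dvd.intro_left _ rfl), Nat.mul_div_cancel _ hr',
        Nat.div_eq_of_lt a.isLt, Nat.div_eq_of_lt b.isLt, add_zero] at h1
      subst h1
      exact ⟨rfl, Fin.ext (by omega)⟩
    · rintro ⟨rfl, rfl⟩
      rfl
  simp only [key, ite_and]
end

section
/- Orthogonality of the degree R−1 matrix biorthogonal polynomial. Let R ≥ 1, z⋆ ∈ ℂ, and 0 < 2ε < ρ. Let Q be a 2×2 matrix of complex polynomials, each entry of degree ≤ R. Let M : ℂ → Matrix 2×2 (ℂ) be analytic on the open ball B(z⋆, ρ), and suppose there is an analytic function N : B(z⋆, ρ) → Matrix 2×2 (ℂ) with (M(w) − 1) · Q(w) = (w − z⋆)^{2R} · N(w) for all w ∈ B(z⋆, ρ), where 1 is the identity matrix and Q(w) denotes entrywise evaluation. Then for every integer j with 0 ≤ j ≤ R−2: ∮_{|z−z⋆|=2ε} ( (1/(2πi)) ∮_{|w−z⋆|=ε} M(w) · ((w−z⋆)^{2R} (w−z))^{−1} dw ) · Q(z) · z^j dz = 0. -/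
open scoped BigOperators
open Polynomial Matrix Complex

lemma aux_swap (c : ℂ) (r s : ℝ) (hr : 0 ≤ r) (hs : 0 ≤ s) (F : ℂ → ℂ → ℂ)
    (hF : ContinuousOn (fun x : ℂ × ℂ => F x.1 x.2)
      (Metric.sphere c r ×ˢ Metric.sphere c s)) :
    (∮ z in C(c, r), ∮ w in C(c, s), F z w) = ∮ w in C(c, s), ∮ z in C(c, r), F z w := by
  simp only [circleIntegral, smul_eq_mul, ← intervalIntegral.integral_const_mul]
  have hcont : Continuous (fun x : ℝ × ℝ =>
      deriv (circleMap c r) x.1 *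
        (deriv (circleMap c s) x.2 * F (circleMap c r x.1) (circleMap c s x.2))) := by
    have h : Continuous (fun x : ℝ × ℝ => F (circleMap c r x.1) (circleMap c s x.2)) := by
      have := hF.comp_continuous
        (f := fun x : ℝ × ℝ => (circleMap c r x.1, circleMap c s x.2))
        (by fun_prop)
        (fun x => ⟨circleMap_mem_sphere c hr _, circleMap_mem_sphere c hs _⟩)
      exact this
    simp only [deriv_circleMap]
    refine Continuous.mul (by fun_prop) (Continuous.mul (by fun_prop) h)
  rw [MeasureTheory.intervalIntegral_intervalIntegral_swap]
  · congr 1; ext θ; congr 1; ext φ; ring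
  · refine (hcont.continuousOn.integrableOn_compact
      (isCompact_uIcc.prod isCompact_uIcc)).mono_set
        (Set.prod_mono Set.uIoc_subset_uIcc Set.uIoc_subset_uIcc)

lemma aux_poly (c : ℂ) (r : ℝ) (hr : 0 < r) (p : Polynomial ℂ) (n : ℕ)
    (hn : p.natDegree + 2 ≤ n) :
    (∮ w in C(c, r), p.eval w / (w - c) ^ n) = 0 := by
  have hne : ∀ w ∈ Metric.sphere c r, w - c ≠ 0 := fun w hw =>
    sub_ne_zero.2 (ne_of_mem_of_not_mem hw (by simpa using hr.ne))
  have h1 : (∮ w in C(c, r), p.eval w / (w - c) ^ n) =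
      ∮ w in C(c, r), ∑ i ∈ Finset.range (p.natDegree + 1),
        (taylor c p).coeff i * (w - c) ^ ((i : ℤ) - n) := by
    refine circleIntegral.integral_congr hr.le fun w hw => ?_
    have h0 := hne w hw
    rw [← taylor_eval_sub c, eval_eq_sum_range, natDegree_taylor, Finset.sum_div]
    refine Finset.sum_congr rfl fun i _ => ?_
    rw [zpow_sub₀ h0, zpow_natCast, zpow_natCast, mul_div_assoc]
  rw [h1, circleIntegral.integral_fun_sum]
  · refine Finset.sum_eq_zero fun i hi => ?_
    rw [circleIntegral.integral_const_mul, circleIntegral.integral_sub_zpow_of_ne, mul_zero]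
    have := Finset.mem_range.1 hi
    omega
  · intro i _
    refine ContinuousOn.circleIntegrable hr.le ?_
    refine continuousOn_const.mul (ContinuousOn.zpow₀ (by fun_prop) _ fun w hw => Or.inl (hne w hw))

/-- Orthogonality of the degree `R−1` matrix biorthogonal polynomial:
for `0 ≤ j ≤ R−2`,
`∮_{|z−z⋆|=2ε} ( (2πi)⁻¹ ∮_{|w−z⋆|=ε} M(w)((w−z⋆)^{2R}(w−z))⁻¹ dw ) Q(z) z^j dz = 0`
(entrywise). -/
theorem stmt_17 (R : ℕ) (hR : 1 ≤ R) (zs : ℂ) (ε ρ : ℝ) (hε : 0 < ε) (hερ : 2 * ε < ρ)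
    (Q : Matrix (Fin 2) (Fin 2) (Polynomial ℂ))
    (hQdeg : ∀ a b : Fin 2, (Q a b).natDegree ≤ R)
    (M N : ℂ → Matrix (Fin 2) (Fin 2) ℂ)
    (hM : ∀ a b : Fin 2, AnalyticOnNhd ℂ (fun w => M w a b) (Metric.ball zs ρ))
    (hN : ∀ a b : Fin 2, AnalyticOnNhd ℂ (fun w => N w a b) (Metric.ball zs ρ))
    (hMQ : ∀ w ∈ Metric.ball zs ρ,
      (M w - 1) * Q.map (Polynomial.eval w) = (w - zs) ^ (2 * R) • N w)
    (j : ℕ) (hj : j + 2 ≤ R) :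
    ∀ a b : Fin 2,
      (∮ z in C(zs, 2 * ε),
        ((Matrix.of fun a' b' : Fin 2 =>
            (2 * (Real.pi : ℂ) * Complex.I)⁻¹ *
              ∮ w in C(zs, ε), M w a' b' / ((w - zs) ^ (2 * R) * (w - z))) *
          Q.map (Polynomial.eval z)) a b * z ^ j) = 0 := by
  intro a b
  have hne : ∀ w ∈ Metric.sphere zs ε, w - zs ≠ 0 := fun w hw =>
    sub_ne_zero.2 (ne_of_mem_of_not_mem hw (by simpa using hε.ne))
  have hwb : ∀ w ∈ Metric.sphere zs ε, w ∈ Metric.ball zs (2 * ε) := fun w hw => by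
    rw [Metric.mem_sphere] at hw; rw [Metric.mem_ball]; linarith
  have hwz : ∀ z ∈ Metric.sphere zs (2 * ε), ∀ w ∈ Metric.sphere zs ε, w - z ≠ 0 := by
    intro z hz w hw h
    rw [sub_eq_zero] at h
    subst h
    rw [Metric.mem_sphere] at hw hz
    linarith
  have hsub : Metric.sphere zs ε ⊆ Metric.ball zs ρ := fun w hw =>
    Metric.ball_subset_ball hερ.le (hwb w hw)
  have hMc : ∀ a b, ContinuousOn (fun w => M w a b) (Metric.sphere zs ε) := fun a b =>
    (hM a b).continuousOn.mono hsub
  have h2 : (2 * ε) ≥ 0 := by positivity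
  let F : ℂ → ℂ → ℂ := fun z w => ∑ c, (2 * (Real.pi : ℂ) * Complex.I)⁻¹ *
    ((Q c b).eval z * z ^ j) * (M w a c / ((w - zs) ^ (2 * R) * (w - z)))
  have e1 : (∮ z in C(zs, 2 * ε),
        ((Matrix.of fun a' b' : Fin 2 =>
            (2 * (Real.pi : ℂ) * Complex.I)⁻¹ *
              ∮ w in C(zs, ε), M w a' b' / ((w - zs) ^ (2 * R) * (w - z))) *
          Q.map (Polynomial.eval z)) a b * z ^ j) =
      ∮ z in C(zs, 2 * ε), ∮ w in C(zs, ε), F z w := by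
    refine circleIntegral.integral_congr h2 fun z hz => ?_
    simp only [F]
    rw [circleIntegral.integral_fun_sum]
    · simp only [circleIntegral.integral_const_mul, Matrix.mul_apply, Matrix.of_apply,
        Matrix.map_apply, Finset.sum_mul]
      refine Finset.sum_congr rfl fun c _ => ?_
      ring
    · intro c _
      refine ContinuousOn.circleIntegrable hε.le ?_
      refine continuousOn_const.mul ((hMc a c).div (by fun_prop) fun w hw => ?_)
      exact mul_ne_zero (pow_ne_zero _ (hne w hw)) (hwz z hz w hw)
  rw [e1, aux_swap _ _ _ h2 hε.le]
  swap
  · refine continuousOn_finsetSum _ fun c _ => ?_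
    refine ContinuousOn.mul (by fun_prop) (ContinuousOn.div ?_ (by fun_prop) fun x hx => ?_)
    · exact (hMc a c).comp continuousOn_snd fun x hx => hx.2
    · exact mul_ne_zero (pow_ne_zero _ (hne _ hx.2)) (hwz _ hx.1 _ hx.2)
  have e2 : (∮ w in C(zs, ε), ∮ z in C(zs, 2 * ε), F z w) =
      ∮ w in C(zs, ε), (-((Q a b * X ^ j).eval w / (w - zs) ^ (2 * R)) - N w a b * w ^ j) := by
    refine circleIntegral.integral_congr hε.le fun w hw => ?_
    let f : ℂ → ℂ := fun z => -((2 * (Real.pi : ℂ) * Complex.I)⁻¹ *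
      (∑ c, (Q c b).eval z * z ^ j * M w a c) / (w - zs) ^ (2 * R))
    have hf : Differentiable ℂ f := by
      simp only [f]
      fun_prop
    have e3 := hf.diffContOnCl.circleIntegral_sub_inv_smul (hwb w hw)
    have e4 : (∮ z in C(zs, 2 * ε), F z w) = ∮ z in C(zs, 2 * ε), (z - w)⁻¹ • f z := by
      refine circleIntegral.integral_congr h2 fun z hz => ?_
      have n1 := hwz z hz w hw
      have n2 := hne w hw
      have n3 : z - w ≠ 0 := fun h => n1 (by linear_combination -h)
      have n4 : (w - z)⁻¹ = - (z - w)⁻¹ := by rw [← inv_neg, neg_sub]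
      simp only [F, f, smul_eq_mul, Fin.sum_univ_two, div_eq_mul_inv, mul_inv, n4]
      ring
    have hq := congrFun (congrFun (hMQ w (hsub hw)) a) b
    have hq' : (∑ c, (Q c b).eval w * w ^ j * M w a c) =
        ((Q a b).eval w + (w - zs) ^ (2 * R) * N w a b) * w ^ j := by
      rw [sub_mul, one_mul] at hq
      simp only [Matrix.sub_apply, Matrix.mul_apply, Matrix.map_apply, Matrix.smul_apply,
        smul_eq_mul, Fin.sum_univ_two] at hq
      rw [Fin.sum_univ_two]
      linear_combination w ^ j * hq
    rw [e4, e3]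
    simp only [f, hq', smul_eq_mul, eval_mul, eval_pow, eval_X]
    have n2 := pow_ne_zero (2 * R) (hne w hw)
    have n5 := Complex.two_pi_I_ne_zero
    generalize (2 * (Real.pi : ℂ) * Complex.I) = t at n5 ⊢
    generalize (w - zs) ^ (2 * R) = u at n2 ⊢
    field_simp
    ring
  have hd : (Q a b * X ^ j).natDegree + 2 ≤ 2 * R := by
    have h1 := natDegree_mul_le (p := Q a b) (q := X ^ j)
    have h3 := hQdeg a b
    rw [natDegree_X_pow] at h1
    omega
  have hNd : DifferentiableOn ℂ (fun w => N w a b * w ^ j) (Metric.ball zs ρ) :=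
    (hN a b).differentiableOn.mul (by fun_prop)
  rw [e2, circleIntegral.integral_sub]
  · have h5 := aux_poly zs ε hε _ _ hd
    have h6 : (∮ w in C(zs, ε), N w a b * w ^ j) = 0 := by
      refine DiffContOnCl.circleIntegral_eq_zero hε.le (DifferentiableOn.diffContOnCl ?_)
      rw [closure_ball _ hε.ne']
      exact hNd.mono (Metric.closedBall_subset_ball (by linarith))
    have h7 : (∮ w in C(zs, ε), -((Q a b * X ^ j).eval w / (w - zs) ^ (2 * R))) = 0 := by
      have := circleIntegral.integral_const_mul (-1)
        (fun w => (Q a b * X ^ j).eval w / (w - zs) ^ (2 * R)) zs ε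
      simpa only [neg_one_mul, h5, neg_zero] using this
    rw [h6, h7, sub_zero]
  · refine ContinuousOn.circleIntegrable hε.le (ContinuousOn.neg (ContinuousOn.div ?_ (by fun_prop)
      fun w hw => pow_ne_zero _ (hne w hw)))
    exact (Q a b * X ^ j).continuous.continuousOn
  · exact ContinuousOn.circleIntegrable hε.le (hNd.continuousOn.mono hsub)
end
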